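/- arXiv:2306.01140 — 3 statements merged into one kernel-verified Lean document; each statement's English description precedes it below -/
import Mathlib

section
/- Let H be a real Hilbert space and T > 0. Let M, A, D : H × H → ℝ be continuous bilinear forms with M and A symmetric, A(v,v) ≥ 0 and D(v,v) ≥ 0 for all v ∈ H. Let U : ℝ → H be twice continuously differentiable, let ℓ : ℝ → H* be a family of continuous linear functionals, and let g : ℝ → ℝ be continuous. Assume that for every t ∈ [0,T] and every v ∈ H: (i) M(U''(t), v) + D(U'(t), v) + A(U(t), v) = ℓ(t)(v), and (ii) |ℓ(t)(v)| ≤ g(t)·√(D(v,v)). Then for every t ∈ [0,T]: M(U'(t), U'(t)) + A(U(t), U(t)) + ∫₀ᵗ D(U'(s), U'(s)) ds ≤ M(U'(0), U'(0)) + A(U(0), U(0)) + ∫₀ᵗ g(s)² ds. (This is the abstract energy stability estimate underlying Theorem 2.2, the stability of the continuous weak formulation of the coupled poroelastic-elastic problem, where the data term is measured in the damping-weighted dual norm.) -/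
/-- The quadratic form of a symmetric bounded bilinear form, evaluated along a differentiable
curve, has derivative twice the form paired with the velocity. -/
theorem hasDerivAt_apply_self_of_symm {H : Type*} [NormedAddCommGroup H] [NormedSpace ℝ H]
    (B : H →L[ℝ] H →L[ℝ] ℝ) (hB : ∀ x y : H, B x y = B y x) {u : ℝ → H} {u' : H} {t : ℝ}
    (hu : HasDerivAt u u' t) :
    HasDerivAt (fun s => B (u s) (u s)) (2 * B u' (u t)) t := by
  have h := (B.hasFDerivAt.comp_hasDerivAt t hu).clm_apply hu
  have heq : 2 * B u' (u t) = B u' (u t) + B (u t) u' := by rw [hB (u t) u', two_mul]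
  rw [heq]
  exact h

/-- Abstract energy stability estimate underlying Theorem 2.2 (stability of the
continuous weak formulation of the coupled poroelastic-elastic problem). -/
theorem energy_stability {H : Type*} [NormedAddCommGroup H] [InnerProductSpace ℝ H]
    [CompleteSpace H]
    (T : ℝ) (hT : 0 < T)
    (M A D : H →L[ℝ] H →L[ℝ] ℝ)
    (hMsymm : ∀ x y : H, M x y = M y x) (hAsymm : ∀ x y : H, A x y = A y x)
    (hApos : ∀ v : H, 0 ≤ A v v) (hDpos : ∀ v : H, 0 ≤ D v v)
    (U : ℝ → H) (hU : ContDiff ℝ 2 U)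
    (ℓ : ℝ → H →L[ℝ] ℝ) (g : ℝ → ℝ) (hg : Continuous g)
    (heq : ∀ t ∈ Set.Icc (0 : ℝ) T, ∀ v : H,
      M (deriv (deriv U) t) v + D (deriv U t) v + A (U t) v = ℓ t v)
    (hbound : ∀ t ∈ Set.Icc (0 : ℝ) T, ∀ v : H,
      |ℓ t v| ≤ g t * Real.sqrt (D v v)) :
    ∀ t ∈ Set.Icc (0 : ℝ) T,
      M (deriv U t) (deriv U t) + A (U t) (U t)
          + ∫ s in (0 : ℝ)..t, D (deriv U s) (deriv U s)
        ≤ M (deriv U 0) (deriv U 0) + A (U 0) (U 0) + ∫ s in (0 : ℝ)..t, (g s) ^ 2 := by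
  intro t ht
  have hU' : ContDiff ℝ 1 (deriv U) := hU.deriv'
  have hdU (s : ℝ) : HasDerivAt U (deriv U s) s :=
    (hU.differentiable (by norm_num) s).hasDerivAt
  have hdU' (s : ℝ) : HasDerivAt (deriv U) (deriv (deriv U) s) s :=
    (hU'.differentiable (by norm_num) s).hasDerivAt
  have cU : Continuous U := hU.continuous
  have cU' : Continuous (deriv U) := hU'.continuous
  have cU'' : Continuous (deriv (deriv U)) := hU'.continuous_deriv le_rfl
  have cD : Continuous fun s => D (deriv U s) (deriv U s) := by fun_prop
  have cg : Continuous fun s => (g s) ^ 2 := by fun_prop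
  have cE : Continuous fun s =>
      2 * M (deriv (deriv U) s) (deriv U s) + 2 * A (deriv U s) (U s) := by fun_prop
  have hE := intervalIntegral.integral_eq_sub_of_hasDerivAt
    (fun s _ => (hasDerivAt_apply_self_of_symm M hMsymm (hdU' s)).add
      (hasDerivAt_apply_self_of_symm A hAsymm (hdU s)))
    (cE.intervalIntegrable 0 t)
  have hmono : ∫ s in (0 : ℝ)..t,
        (2 * M (deriv (deriv U) s) (deriv U s) + 2 * A (deriv U s) (U s))
      ≤ ∫ s in (0 : ℝ)..t, ((g s) ^ 2 - D (deriv U s) (deriv U s)) := by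
    refine intervalIntegral.integral_mono_on ht.1 (cE.intervalIntegrable 0 t)
      ((cg.sub cD).intervalIntegrable 0 t) fun s hs => ?_
    have hsT : s ∈ Set.Icc (0 : ℝ) T := ⟨hs.1, hs.2.trans ht.2⟩
    have hweak := heq s hsT (deriv U s)
    have hload := (le_abs_self _).trans (hbound s hsT (deriv U s))
    have hsqrt := Real.sq_sqrt (hDpos (deriv U s))
    rw [hAsymm (deriv U s) (U s)]
    nlinarith [sq_nonneg (g s - Real.sqrt (D (deriv U s) (deriv U s)))]
  rw [intervalIntegral.integral_sub (cg.intervalIntegrable 0 t)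
    (cD.intervalIntegrable 0 t)] at hmono
  simp only [Pi.add_apply] at hE
  linarith
end

section
/- Let n ≥ 1 and T > 0. Let M, D, K be real symmetric n×n matrices with vᵀ·D·v ≥ 0 and vᵀ·K·v ≥ 0 for all v ∈ ℝⁿ. Let u : ℝ → ℝⁿ be twice continuously differentiable, F : ℝ → ℝⁿ, and g : ℝ → ℝ continuous, and assume that for all t ∈ [0,T]: (i) M·u''(t) + D·u'(t) + K·u(t) = F(t), and (ii) |⟨F(t), v⟩| ≤ g(t)·√(vᵀ·D·v) for all v ∈ ℝⁿ. Then for all t ∈ [0,T]: u'(t)ᵀ·M·u'(t) + u(t)ᵀ·K·u(t) + ∫₀ᵗ u'(s)ᵀ·D·u'(s) ds ≤ u'(0)ᵀ·M·u'(0) + u(0)ᵀ·K·u(0) + ∫₀ᵗ g(s)² ds. (This is the stability estimate of Theorem 3.5 for the semi-discrete PolydG formulation, stated for its equivalent algebraic form M·Ü + D·U̇ + (A+B+C)·U = F.) -/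
open Matrix

/-- Derivative of the quadratic form of a symmetric matrix along a differentiable curve. -/
theorem hasDerivAt_dotProduct_mulVec_self {ι : Type*} [Fintype ι] {A : Matrix ι ι ℝ}
    (hA : A.IsSymm) {v : ℝ → ι → ℝ} {v' : ι → ℝ} {t : ℝ} (hv : HasDerivAt v v' t) :
    HasDerivAt (fun s => v s ⬝ᵥ A.mulVec (v s)) (2 * (v t ⬝ᵥ A.mulVec v')) t := by
  have hAv : HasDerivAt (fun s => A.mulVec (v s)) (A.mulVec v') t :=
    A.mulVecLin.toContinuousLinearMap.hasFDerivAt.comp_hasDerivAt t hv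
  have hsum := HasDerivAt.fun_sum (u := Finset.univ) fun i _ =>
    (hasDerivAt_pi.1 hv i).mul (hasDerivAt_pi.1 hAv i)
  refine hsum.congr_deriv ?_
  have hsymm : v' ⬝ᵥ A.mulVec (v t) = v t ⬝ᵥ A.mulVec v' := by
    rw [dotProduct_mulVec, ← mulVec_transpose, hA.eq, dotProduct_comm]
  rw [Finset.sum_add_distrib, two_mul]
  exact congrArg (· + _) hsymm

/-- Stability estimate of Theorem 3.5 for the semi-discrete PolydG formulation,
stated for its equivalent algebraic form `M·Ü + D·U̇ + K·U = F`. -/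
theorem semidiscrete_stability (n : ℕ) (hn : 1 ≤ n) (T : ℝ) (hT : 0 < T)
    (M D K : Matrix (Fin n) (Fin n) ℝ)
    (hM : M.IsSymm) (hD : D.IsSymm) (hK : K.IsSymm)
    (hDpos : ∀ v : Fin n → ℝ, 0 ≤ v ⬝ᵥ D.mulVec v)
    (hKpos : ∀ v : Fin n → ℝ, 0 ≤ v ⬝ᵥ K.mulVec v)
    (u : ℝ → Fin n → ℝ) (hu : ContDiff ℝ 2 u)
    (F : ℝ → Fin n → ℝ) (hF : Continuous F)
    (g : ℝ → ℝ) (hg : Continuous g)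
    (heq : ∀ t ∈ Set.Icc (0 : ℝ) T,
      M.mulVec (deriv (deriv u) t) + D.mulVec (deriv u t) + K.mulVec (u t) = F t)
    (hbound : ∀ t ∈ Set.Icc (0 : ℝ) T, ∀ v : Fin n → ℝ,
      |F t ⬝ᵥ v| ≤ g t * Real.sqrt (v ⬝ᵥ D.mulVec v)) :
    ∀ t ∈ Set.Icc (0 : ℝ) T,
      deriv u t ⬝ᵥ M.mulVec (deriv u t) + u t ⬝ᵥ K.mulVec (u t)
          + ∫ s in (0 : ℝ)..t, deriv u s ⬝ᵥ D.mulVec (deriv u s)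
        ≤ deriv u 0 ⬝ᵥ M.mulVec (deriv u 0) + u 0 ⬝ᵥ K.mulVec (u 0)
          + ∫ s in (0 : ℝ)..t, (g s) ^ 2 := by
  rintro t ⟨ht0, htT⟩
  have hu1 : ContDiff ℝ 1 (deriv u) :=
    (contDiff_succ_iff_deriv.1
      (show ContDiff ℝ (1 + 1) u by simpa [one_add_one_eq_two] using hu)).2.2
  have hcu := hu.continuous
  have hcdu := hu1.continuous
  have hcddu : Continuous (deriv (deriv u)) := hu1.continuous_deriv le_rfl
  have hderiv (s : ℝ) : HasDerivAt
      (fun s => deriv u s ⬝ᵥ M.mulVec (deriv u s) + u s ⬝ᵥ K.mulVec (u s))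
      (2 * (deriv u s ⬝ᵥ M.mulVec (deriv (deriv u) s)) + 2 * (u s ⬝ᵥ K.mulVec (deriv u s))) s :=
    (hasDerivAt_dotProduct_mulVec_self hM
      (hu1.differentiable one_ne_zero s).hasDerivAt).add
    (hasDerivAt_dotProduct_mulVec_self hK
      (hu.differentiable two_ne_zero s).hasDerivAt)
  have hcE : Continuous fun s => 2 * (deriv u s ⬝ᵥ M.mulVec (deriv (deriv u) s))
      + 2 * (u s ⬝ᵥ K.mulVec (deriv u s)) := by
    fun_prop
  have hcD : Continuous fun s => deriv u s ⬝ᵥ D.mulVec (deriv u s) := by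
    fun_prop
  have hcg : Continuous fun s => g s ^ 2 := hg.pow 2
  have henergy := intervalIntegral.integral_eq_sub_of_hasDerivAt (fun s _ => hderiv s)
    (hcE.intervalIntegrable 0 t)
  have hmono := intervalIntegral.integral_mono_on (μ := MeasureTheory.volume) ht0 (hcE.intervalIntegrable 0 t)
    ((hcg.sub hcD).intervalIntegrable 0 t) fun s hs => by
      have hs' : s ∈ Set.Icc (0 : ℝ) T := ⟨hs.1, hs.2.trans htT⟩
      have hF_le := (le_abs_self _).trans (hbound s hs' (deriv u s))
      have hsq := Real.sq_sqrt (hDpos (deriv u s))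
      have hsymm : u s ⬝ᵥ K.mulVec (deriv u s) = deriv u s ⬝ᵥ K.mulVec (u s) := by
        rw [dotProduct_mulVec, ← mulVec_transpose, hK.eq, dotProduct_comm]
      rw [dotProduct_comm, ← heq s hs', dotProduct_add, dotProduct_add] at hF_le
      simp only [hsymm, Pi.sub_apply]
      nlinarith [sq_nonneg (g s - √(deriv u s ⬝ᵥ D.mulVec (deriv u s)))]
  simp only [Pi.sub_apply] at hmono
  rw [henergy, intervalIntegral.integral_sub (hcg.intervalIntegrable 0 t)
    (hcD.intervalIntegrable 0 t)] at hmono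
  linarith
end

section
/- Let ρ_s > 0, ρ_f > 0, 0 < φ < 1, a > 1, λ ≥ 0, μ > 0, m > 0, and β ∈ ℝ be real numbers. Set ρ_p = φ·ρ_f + (1−φ)·ρ_s, ρ_w = (a/φ)·ρ_f, A = [[ρ_p, ρ_f], [ρ_f, ρ_w]], and B = [[λ + 2μ + m·β², m·β], [m·β, m]]. If v ∈ ℝ² is nonzero and Λ ∈ ℝ satisfies A·v = Λ·(B·v), then Λ > 0. (Hence the generalized eigenvalues Λ of the pencil (A, B) are strictly positive, so the fast and slow compressional wave velocities c_pI = max √Λ and c_pII = min √Λ are well defined.) -/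
open Matrix

/-- The generalized eigenvalues `Λ` of the pencil `(A, B)` defining the fast and slow
compressional wave velocities are strictly positive. -/
theorem generalized_eigenvalues_pos (ρs ρf φ a lam μ m β : ℝ)
    (hρs : 0 < ρs) (hρf : 0 < ρf) (hφ0 : 0 < φ) (hφ1 : φ < 1) (ha : 1 < a)
    (hlam : 0 ≤ lam) (hμ : 0 < μ) (hm : 0 < m)
    (ρp ρw : ℝ)
    (hρp : ρp = φ * ρf + (1 - φ) * ρs)
    (hρw : ρw = (a / φ) * ρf)
    (A B : Matrix (Fin 2) (Fin 2) ℝ)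
    (hA : A = !![ρp, ρf; ρf, ρw])
    (hB : B = !![lam + 2 * μ + m * β ^ 2, m * β; m * β, m])
    (v : Fin 2 → ℝ) (hv : v ≠ 0) (Λ : ℝ)
    (heig : A.mulVec v = Λ • B.mulVec v) :
    0 < Λ := by
  have hxy : 0 < v 0 ^ 2 ∨ 0 < v 1 ^ 2 := by
    by_contra! h
    refine hv (funext fun i => ?_)
    fin_cases i
    · exact pow_eq_zero_iff two_ne_zero |>.mp (le_antisymm h.1 (sq_nonneg _))
    · exact pow_eq_zero_iff two_ne_zero |>.mp (le_antisymm h.2 (sq_nonneg _))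
  have h0 := congrFun heig 0
  have h1 := congrFun heig 1
  simp only [hA, hB, mulVec, dotProduct, Fin.sum_univ_two, Pi.smul_apply, smul_eq_mul,
    of_apply, cons_val_zero, cons_val_one, cons_val', cons_val_fin_one] at h0 h1
  set x := v 0
  set y := v 1
  have hAform : x * (ρp * x + ρf * y) + y * (ρf * x + ρw * y) =
      ρf / φ * ((φ * x + y) ^ 2 + (a - 1) * y ^ 2) + (1 - φ) * ρs * x ^ 2 := by
    rw [hρp, hρw]
    field_simp
    ring
  have hApos : 0 < x * (ρp * x + ρf * y) + y * (ρf * x + ρw * y) := by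
    have ha' : 0 < a - 1 := sub_pos.mpr ha
    have hφ' : 0 < 1 - φ := sub_pos.mpr hφ1
    rw [hAform]
    rcases hxy with hx | hy <;> positivity
  have hBnonneg : 0 ≤ (lam + 2 * μ) * x ^ 2 + m * (β * x + y) ^ 2 := by positivity
  have hΛ : x * (ρp * x + ρf * y) + y * (ρf * x + ρw * y) =
      Λ * ((lam + 2 * μ) * x ^ 2 + m * (β * x + y) ^ 2) := by
    rw [h0, h1]
    ring
  exact pos_of_mul_pos_left (hΛ ▸ hApos) hBnonneg
end
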